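/- Let a > 0 and t > 0, and define the operator G(s) for s ≥ 0 on functions f : ℝ → ℝ by (G(s)f)(x) = (1/4)·f(x + 2a√s) + (1/4)·f(x − 2a√s) + (1/2)·f(x). Then for every positive integer n and every x ∈ ℝ, ((G(t/n))^n sin)(x) = (cos(a·√(t/n)))^{2n}·sin(x). -/

import Mathlib

open Real Function

theorem chernoff_heat_first_iterate_sin
    (a t : ℝ) (ha : 0 < a) (ht : 0 < t)
    (G : ℝ → (ℝ → ℝ) → (ℝ → ℝ))
    (hG : ∀ s : ℝ, 0 ≤ s → ∀ (f : ℝ → ℝ) (x : ℝ),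
      G s f x = (1 / 4) * f (x + 2 * a * Real.sqrt s)
        + (1 / 4) * f (x - 2 * a * Real.sqrt s) + (1 / 2) * f x)
    (n : ℕ) (hn : 0 < n) (x : ℝ) :
    (G (t / n))^[n] Real.sin x
      = Real.cos (a * Real.sqrt (t / n)) ^ (2 * n) * Real.sin x := by
  have hs : (0 : ℝ) ≤ t / n := by positivity
  have key : ∀ m : ℕ, (G (t / n))^[m] Real.sin
      = fun y => Real.cos (a * Real.sqrt (t / n)) ^ (2 * m) * Real.sin y := by
    intro m
    induction m with
    | zero => funext y; simp
    | succ k ih =>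
      funext y
      rw [Function.iterate_succ_apply', ih, hG _ hs]
      have h2 : 2 * a * Real.sqrt (t / n) = 2 * (a * Real.sqrt (t / n)) := by ring
      simp only [h2, Real.sin_add, Real.sin_sub, Real.cos_two_mul]
      ring
  rw [key n]
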